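/- Let f : (0,∞) → ℂ be locally absolutely continuous, of bounded variation on (0,∞), with lim_{t→∞} f(t) = 0 (so that f' is Lebesgue integrable on (0,∞)). Define the tail integral I(x) = ∫_{π/(2x)}^∞ f(t) sin(xt) dt for x > 0. Then I(x) = H_0(T_{f'})(x) + G(x), where the function G satisfies ‖G‖_{L^1(0,∞)} ≤ C ‖f'‖_{L^1(0,∞)} for an absolute constant C > 0. -/

import Mathlib

open MeasureTheory Filter Set Real

/-- Integration by parts bounds an oscillatory integral with monotone amplitude. -/
lemma abs_integral_mul_sin_le {φ φ' : ℝ → ℝ} {a b v c : ℝ} (hab : a ≤ b) (hv : 0 < v)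
    (hφ : ∀ r ∈ Icc a b, HasDerivAt φ (φ' r) r) (hφ' : ContinuousOn φ' (Icc a b))
    (hpos : ∀ r ∈ Icc a b, 0 ≤ φ' r) :
    |∫ r in a..b, φ r * sin (r * v + c)| ≤ 2 * (|φ a| + |φ b|) / v := by
  have hI : uIcc a b = Icc a b := uIcc_of_le hab
  have hint : IntervalIntegrable φ' volume a b :=
    ContinuousOn.intervalIntegrable (by rwa [hI])
  have hosc : ∀ r ∈ uIcc a b,
      HasDerivAt (fun r => -cos (r * v + c) / v) (sin (r * v + c)) r := by
    intro r _
    have h := ((((hasDerivAt_id r).mul_const v).add_const c).cos).neg.div_const v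
    exact h.congr_deriv (by simp only [id]; field_simp)
  have hparts := intervalIntegral.integral_mul_deriv_eq_deriv_mul
    (u := φ) (v := fun r => -cos (r * v + c) / v) (by rwa [hI]) hosc hint
    (Continuous.intervalIntegrable (by fun_prop) _ _)
  have hcos : ∀ y : ℝ, |-cos y / v| ≤ 1 / v := by
    intro y
    rw [abs_div, abs_neg, abs_of_pos hv]
    gcongr
    exact abs_cos_le_one y
  have hrem : |∫ r in a..b, φ' r * (-cos (r * v + c) / v)| ≤ (φ b - φ a) / v := by
    have hmono := intervalIntegral.norm_integral_le_of_norm_le (μ := volume)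
      (f := fun r => φ' r * (-cos (r * v + c) / v)) (g := fun r => φ' r * (1 / v)) hab
      (Eventually.of_forall fun r hr => by
        rw [norm_mul, norm_eq_abs, norm_eq_abs, abs_of_nonneg (hpos r (Ioc_subset_Icc_self hr))]
        exact mul_le_mul_of_nonneg_left (hcos _) (hpos r (Ioc_subset_Icc_self hr)))
      (hint.mul_const _)
    rw [intervalIntegral.integral_mul_const,
      intervalIntegral.integral_eq_sub_of_hasDerivAt (by rwa [hI]) hint] at hmono
    simpa [div_eq_mul_inv] using hmono
  rw [hparts]
  have hb := mul_le_mul_of_nonneg_left (hcos (b * v + c)) (abs_nonneg (φ b))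
  have ha := mul_le_mul_of_nonneg_left (hcos (a * v + c)) (abs_nonneg (φ a))
  rw [← abs_mul] at ha hb
  have h3 : (φ b - φ a) / v ≤ (|φ a| + |φ b|) / v := by
    gcongr
    linarith [neg_abs_le (φ a), le_abs_self (φ b)]
  calc _ ≤ |φ b * (-cos (b * v + c) / v)| + |φ a * (-cos (a * v + c) / v)|
        + |∫ r in a..b, φ' r * (-cos (r * v + c) / v)| := by
        exact (abs_sub _ _).trans (add_le_add_left (abs_sub _ _) _)
    _ ≤ |φ b| * (1 / v) + |φ a| * (1 / v) + (|φ a| + |φ b|) / v := by linarith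
    _ = _ := by ring

lemma integral_exp_neg_mul_sin (t y : ℝ) :
    ∫ r in (0 : ℝ)..y, exp (-(t * r)) * sin r =
      (1 + t ^ 2)⁻¹ - exp (-(y * t)) * (cos y + t * sin y) * (1 + t ^ 2)⁻¹ := by
  have hne : 1 + t ^ 2 ≠ 0 := by positivity
  have hderiv : ∀ r ∈ uIcc 0 y, HasDerivAt
      (fun r => -(exp (-(t * r)) * (cos r + t * sin r)) * (1 + t ^ 2)⁻¹)
      (exp (-(t * r)) * sin r) r := by
    intro r _
    have h := (((((hasDerivAt_id r).const_mul t).neg.exp).mul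
      ((hasDerivAt_cos r).add ((hasDerivAt_sin r).const_mul t))).neg).mul_const (1 + t ^ 2)⁻¹
    refine h.congr_deriv ?_
    simp only [Pi.neg_apply, Pi.add_apply, id]
    field_simp
    ring
  rw [intervalIntegral.integral_eq_sub_of_hasDerivAt hderiv
    (Continuous.intervalIntegrable (by fun_prop) _ _)]
  simp
  ring_nf

lemma integrableOn_exp_neg_mul_Ioi {y : ℝ} (hy : 0 < y) :
    IntegrableOn (fun t => exp (-(y * t))) (Ioi 0) := by
  simpa using integrableOn_exp_mul_Ioi (neg_neg_of_pos hy) 0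

lemma integral_exp_neg_mul_Ioi {y : ℝ} (hy : 0 < y) :
    ∫ t in Ioi (0 : ℝ), exp (-(y * t)) = 1 / y := by
  simpa using integral_exp_mul_Ioi (neg_neg_of_pos hy) 0

lemma abs_cos_add_mul_sin_le (t y : ℝ) : |cos y + t * sin y| ≤ 1 + t ^ 2 := by
  rw [abs_le]
  constructor <;>
  nlinarith [sin_sq_add_cos_sq y, sq_nonneg (sin y - t * cos y), sq_nonneg (cos y + t * sin y),
    sq_nonneg t, sq_nonneg (cos y + t * sin y - 1), sq_nonneg (cos y + t * sin y + 1)]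

/-- The sine integral converges to `π / 2` at rate `1 / y`. -/
lemma abs_integral_sinc_sub_pi_div_two_le {y : ℝ} (hy : 0 < y) :
    |(∫ r in (0 : ℝ)..y, sinc r) - π / 2| ≤ 1 / y := by
  have hinner : ∀ r ∈ Ioc 0 y, ∫ t in Ioi (0 : ℝ), exp (-(r * t)) * sin r = sinc r := by
    intro r hr
    rw [integral_mul_const, integral_exp_neg_mul_Ioi hr.1, sinc_of_ne_zero hr.1.ne']
    ring
  have hinnerabs : ∀ r ∈ Ioc 0 y, ∫ t in Ioi (0 : ℝ), ‖exp (-(r * t)) * sin r‖ = |sinc r| := by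
    intro r hr
    simp only [norm_mul, norm_eq_abs, abs_exp]
    rw [integral_mul_const, integral_exp_neg_mul_Ioi hr.1, sinc_of_ne_zero hr.1.ne', abs_div,
      abs_of_pos hr.1]
    ring
  have hprod : Integrable (Function.uncurry fun r t : ℝ => exp (-(r * t)) * sin r)
      ((volume.restrict (Ioc 0 y)).prod (volume.restrict (Ioi 0))) := by
    refine (integrable_prod_iff (Continuous.aestronglyMeasurable ?_)).2 ⟨?_, ?_⟩
    · simp only [Function.uncurry_def]; fun_prop
    · filter_upwards [ae_restrict_mem measurableSet_Ioc] with r hr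
      exact Integrable.mul_const (integrableOn_exp_neg_mul_Ioi hr.1) (sin r)
    · have : IntegrableOn (fun r => |sinc r|) (Ioc 0 y) :=
        (continuous_sinc.abs.integrableOn_Icc).mono_set Ioc_subset_Icc_self
      refine this.congr ?_
      filter_upwards [ae_restrict_mem measurableSet_Ioc] with r hr
      exact (hinnerabs r hr).symm
  have hswap : ∫ r in (0 : ℝ)..y, sinc r =
      ∫ t in Ioi (0 : ℝ), ((1 + t ^ 2)⁻¹ -
        exp (-(y * t)) * (cos y + t * sin y) * (1 + t ^ 2)⁻¹) := by
    rw [intervalIntegral.integral_of_le hy.le,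
      ← setIntegral_congr_fun measurableSet_Ioc hinner, integral_integral_swap hprod]
    refine integral_congr_ae (Eventually.of_forall fun t => ?_)
    simp only
    rw [← integral_exp_neg_mul_sin, intervalIntegral.integral_of_le hy.le]
    simp only [mul_comm]
  have hbound : ∀ t : ℝ, ‖exp (-(y * t)) * (cos y + t * sin y) * (1 + t ^ 2)⁻¹‖ ≤
      exp (-(y * t)) := by
    intro t
    have hpos : 0 < 1 + t ^ 2 := by positivity
    rw [norm_mul, norm_mul, norm_eq_abs, abs_exp, norm_eq_abs, norm_eq_abs,
      abs_of_pos (inv_pos.2 hpos), mul_assoc]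
    refine mul_le_of_le_one_right (exp_pos _).le ?_
    rw [← div_eq_mul_inv, div_le_one hpos]
    exact abs_cos_add_mul_sin_le t y
  have hrem : IntegrableOn
      (fun t => exp (-(y * t)) * (cos y + t * sin y) * (1 + t ^ 2)⁻¹) (Ioi 0) :=
    (integrableOn_exp_neg_mul_Ioi hy).mono'
      (by
        refine Continuous.aestronglyMeasurable ?_
        refine Continuous.mul (by fun_prop) (Continuous.inv₀ (by fun_prop) fun t => ?_)
        positivity)
      (Eventually.of_forall hbound)
  rw [hswap, integral_sub integrable_inv_one_add_sq.integrableOn hrem,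
    integral_Ioi_inv_one_add_sq, arctan_zero, sub_zero, sub_sub_cancel_left, abs_neg,
    ← integral_exp_neg_mul_Ioi hy]
  exact norm_integral_le_of_norm_le (integrableOn_exp_neg_mul_Ioi hy)
    (Eventually.of_forall hbound)

lemma abs_integral_sinc_le {y : ℝ} (hy : 0 ≤ y) : |∫ r in (0 : ℝ)..y, sinc r| ≤ 3 := by
  rcases le_total y 3 with h | h
  · have := intervalIntegral.norm_integral_le_of_norm_le_const (a := 0) (b := y) (f := sinc)
      (C := 1) (fun r _ => abs_sinc_le_one r)
    rw [norm_eq_abs, sub_zero, abs_of_nonneg hy] at this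
    linarith
  · have hle := abs_integral_sinc_sub_pi_div_two_le (show 0 < y by linarith)
    have : 1 / y ≤ 1 := by rw [div_le_one] <;> linarith
    rw [abs_le] at hle ⊢
    constructor <;> linarith [hle.1, hle.2, pi_pos, pi_le_four]

/-- The kernel `∫ sin (s v) / (s² - 1) ds` over `s > 0`, truncated at distance `ε` from its pole. -/
noncomputable def truncatedKernel (ε v : ℝ) : ℝ :=
  ∫ s in {s : ℝ | 0 < s ∧ ε < |s - 1|}, sin (s * v) / (s ^ 2 - 1)

/-- The sum of the values of `sin (s v) / (s² - 1)` at `s = 1 + r` and `s = 1 - r`, with its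
removable singularity at `r = 0` removed. -/
noncomputable def foldedIntegrand (v r : ℝ) : ℝ :=
  cos v * (v * sinc (r * v)) + cos v * (r / (4 - r ^ 2) * sin (r * v)) -
    2 * sin v * (1 / (4 - r ^ 2) * cos (r * v))

/-- The part of the kernel that lies away from the pole. -/
noncomputable def tailKernel (v : ℝ) : ℝ := ∫ s in Ioi (2 : ℝ), sin (s * v) / (s ^ 2 - 1)

/-- The principal value `∫ sin (s v) / (s² - 1) ds` over `s > 0`. -/
noncomputable def principalKernel (v : ℝ) : ℝ :=
  (∫ r in (0 : ℝ)..1, foldedIntegrand v r) + tailKernel v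

lemma measurableSet_setOf_pos_and_lt_abs_sub (x δ : ℝ) :
    MeasurableSet {t : ℝ | 0 < t ∧ δ < |t - x|} :=
  measurableSet_Ioi.inter (measurableSet_lt measurable_const (measurable_id.sub_const x).abs)

lemma integrableOn_one_div_sq_sub_sq {x δ : ℝ} (hx : 0 < x) (hδ : 0 < δ) :
    IntegrableOn (fun t : ℝ => 1 / (t ^ 2 - x ^ 2)) {t : ℝ | 0 < t ∧ δ < |t - x|} := by
  have hmaj : Integrable (fun t : ℝ => (1 + δ ^ 2) / δ ^ 2 * (1 + (t - x) ^ 2)⁻¹) :=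
    (integrable_inv_one_add_sq.comp_sub_right x).const_mul _
  refine Integrable.mono' hmaj.integrableOn (Measurable.aestronglyMeasurable (by fun_prop)) ?_
  filter_upwards [ae_restrict_mem (measurableSet_setOf_pos_and_lt_abs_sub x δ)] with t ht
  obtain ⟨ht0, ht1⟩ := ht
  have hsq : δ ^ 2 ≤ (t - x) ^ 2 := by
    rw [← sq_abs (t - x)]
    gcongr
  have habs : (t - x) ^ 2 ≤ |t ^ 2 - x ^ 2| := by
    rw [show t ^ 2 - x ^ 2 = (t - x) * (t + x) by ring, abs_mul, ← sq_abs (t - x), sq]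
    refine mul_le_mul_of_nonneg_left ?_ (abs_nonneg _)
    rw [abs_of_pos (show 0 < t + x by linarith), abs_le]
    constructor <;> linarith
  have hδ2 : 0 < δ ^ 2 := by positivity
  rw [norm_div, norm_one, norm_eq_abs, ← div_eq_mul_inv, div_div,
    div_le_div_iff₀ (by linarith) (by positivity)]
  nlinarith [mul_le_mul_of_nonneg_left habs (show 0 ≤ 1 + δ ^ 2 by positivity)]

lemma integrableOn_sin_div_sq_sub_one {ε : ℝ} (hε : 0 < ε) (v : ℝ) :
    IntegrableOn (fun s : ℝ => sin (s * v) / (s ^ 2 - 1)) {s : ℝ | 0 < s ∧ ε < |s - 1|} := by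
  have hint := integrableOn_one_div_sq_sub_sq one_pos hε
  rw [one_pow] at hint
  refine Integrable.mono hint (Measurable.aestronglyMeasurable (by fun_prop))
    (Eventually.of_forall fun s => ?_)
  rw [norm_div, norm_div, norm_one]
  gcongr
  exact abs_sin_le_one _

lemma sin_div_add_sin_div_eq_foldedIntegrand (v : ℝ) {r : ℝ} (hr0 : 0 < r) (hr1 : r ≤ 1) :
    sin ((1 - r) * v) / ((1 - r) ^ 2 - 1) + sin ((1 + r) * v) / ((1 + r) ^ 2 - 1) =
      foldedIntegrand v r := by
  have hsinc : v * sinc (r * v) = sin (r * v) / r := by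
    rcases eq_or_ne v 0 with rfl | hv
    · simp
    · rw [sinc_of_ne_zero (mul_ne_zero hr0.ne' hv)]
      field_simp
  have h1 : (1 - r) ^ 2 - 1 = -(r * (2 - r)) := by ring
  have h2 : (1 + r) ^ 2 - 1 = r * (2 + r) := by ring
  have h3 : (4 : ℝ) - r ^ 2 = (2 - r) * (2 + r) := by ring
  have h4 : (2 : ℝ) - r ≠ 0 := by linarith
  have h5 : (2 : ℝ) + r ≠ 0 := by linarith
  rw [foldedIntegrand, hsinc, h1, h2, h3, sub_mul, add_mul, one_mul, sin_sub, sin_add]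
  field_simp
  ring

lemma truncatedKernel_eq {ε : ℝ} (hε0 : 0 < ε) (hε1 : ε < 1) (v : ℝ) :
    truncatedKernel ε v = (∫ r in ε..1, foldedIntegrand v r) + tailKernel v := by
  have hset : {s : ℝ | 0 < s ∧ ε < |s - 1|} = Ioo 0 (1 - ε) ∪ (Ioc (1 + ε) 2 ∪ Ioi 2) := by
    rw [Ioc_union_Ioi_eq_Ioi (by linarith)]
    ext s
    simp only [mem_ofPred_eq, lt_abs, mem_union, mem_Ioo, mem_Ioi]
    constructor
    · rintro ⟨h, h' | h'⟩
      · right; linarith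
      · left; constructor <;> linarith
    · rintro (⟨h, h'⟩ | h)
      · exact ⟨h, Or.inr (by linarith)⟩
      · exact ⟨by linarith, Or.inl (by linarith)⟩
  have hint := integrableOn_sin_div_sq_sub_one hε0 v
  rw [hset] at hint
  have hlow := hint.mono_set subset_union_left
  have hmid := hint.mono_set (subset_union_left.trans subset_union_right)
  have hhigh := hint.mono_set (subset_union_right.trans subset_union_right)
  have hlow' : IntervalIntegrable (fun s => sin (s * v) / (s ^ 2 - 1)) volume 0 (1 - ε) := by
    rwa [intervalIntegrable_iff_integrableOn_Ioo_of_le (by linarith)]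
  have hmid' : IntervalIntegrable (fun s => sin (s * v) / (s ^ 2 - 1)) volume (1 + ε) 2 := by
    rwa [intervalIntegrable_iff_integrableOn_Ioc_of_le (by linarith)]
  have hreflect := hlow'.comp_sub_left 1
  have hshift := hmid'.comp_add_left 1
  have hfold : ∫ r in ε..1, foldedIntegrand v r =
      (∫ s in (0 : ℝ)..(1 - ε), sin (s * v) / (s ^ 2 - 1)) +
        ∫ s in (1 + ε)..2, sin (s * v) / (s ^ 2 - 1) := by
    have hr := intervalIntegral.integral_comp_sub_left
      (a := ε) (b := 1) (fun s => sin (s * v) / (s ^ 2 - 1)) 1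
    have hs := intervalIntegral.integral_comp_add_left
      (a := ε) (b := 1) (fun s => sin (s * v) / (s ^ 2 - 1)) 1
    rw [sub_self] at hr
    rw [one_add_one_eq_two] at hs
    rw [← hr, ← hs, ← intervalIntegral.integral_add]
    · refine intervalIntegral.integral_congr_ae (Eventually.of_forall fun r hr => ?_)
      rw [uIoc_of_le hε1.le] at hr
      exact (sin_div_add_sin_div_eq_foldedIntegrand v (hε0.trans hr.1) hr.2).symm
    · simpa using hreflect.symm
    · convert hshift using 1 <;> ring
  have hdisj : Disjoint (Ioc (1 + ε) 2) (Ioi 2) :=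
    disjoint_left.2 fun s hs hs' => not_lt_of_ge hs.2 hs'
  have hdisj' : Disjoint (Ioo 0 (1 - ε)) (Ioc (1 + ε) 2 ∪ Ioi 2) := by
    rw [Ioc_union_Ioi_eq_Ioi (by linarith)]
    exact disjoint_left.2 fun s hs hs' => by
      simp only [mem_Ioo, mem_Ioi] at hs hs'
      linarith
  rw [truncatedKernel, hset, setIntegral_union hdisj' (by measurability) hlow (hmid.union hhigh),
    setIntegral_union hdisj measurableSet_Ioi hmid hhigh, hfold, tailKernel,
    intervalIntegral.integral_of_le (by linarith), intervalIntegral.integral_of_le (by linarith),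
    ← integral_Ioc_eq_integral_Ioo, add_assoc]

lemma continuousOn_foldedIntegrand (v : ℝ) : ContinuousOn (foldedIntegrand v) (Icc 0 1) := by
  have hne : ∀ r ∈ Icc (0 : ℝ) 1, 4 - r ^ 2 ≠ 0 := fun r hr => by nlinarith [hr.1, hr.2]
  have hsinc : Continuous fun r => sinc (r * v) := continuous_sinc.comp (by fun_prop)
  unfold foldedIntegrand
  fun_prop (disch := assumption)

lemma tendsto_truncatedKernel (v : ℝ) :
    Tendsto (fun ε => truncatedKernel ε v) (nhdsWithin 0 (Ioi 0)) (nhds (principalKernel v)) := by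
  have hint : IntegrableOn (foldedIntegrand v) (uIcc 1 0) := by
    rw [uIcc_of_ge zero_le_one]
    exact (continuousOn_foldedIntegrand v).integrableOn_Icc
  have hprim := (intervalIntegral.continuousOn_primitive_interval hint) 0 right_mem_uIcc
  rw [uIcc_of_ge zero_le_one] at hprim
  have hlim : Tendsto (fun ε => ∫ r in ε..1, foldedIntegrand v r) (nhdsWithin 0 (Ioc 0 1))
      (nhds (∫ r in (0 : ℝ)..1, foldedIntegrand v r)) := by
    simp_rw [intervalIntegral.integral_symm 1]
    exact (hprim.mono Ioc_subset_Icc_self).neg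
  rw [nhdsWithin_Ioc_eq_nhdsGT zero_lt_one] at hlim
  refine (hlim.add_const (tailKernel v)).congr' ?_
  filter_upwards [Ioo_mem_nhdsGT zero_lt_one] with ε hε
  exact (truncatedKernel_eq hε.1 hε.2 v).symm

lemma integral_foldedIntegrand_eq {ε : ℝ} (hε0 : 0 ≤ ε) (hε1 : ε ≤ 1) (v : ℝ) :
    ∫ r in ε..1, foldedIntegrand v r =
      cos v * ((∫ r in (0 : ℝ)..v, sinc r) - ∫ r in (0 : ℝ)..(ε * v), sinc r) +
        cos v * (∫ r in ε..1, r / (4 - r ^ 2) * sin (r * v)) -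
        2 * sin v * ∫ r in ε..1, 1 / (4 - r ^ 2) * cos (r * v) := by
  have hne : ∀ r ∈ uIcc ε 1, 4 - r ^ 2 ≠ 0 := fun r hr => by
    rw [uIcc_of_le hε1] at hr
    nlinarith [hr.1, hr.2]
  have hsinc : Continuous fun r => sinc (r * v) := continuous_sinc.comp (by fun_prop)
  have h1 : IntervalIntegrable (fun r => cos v * (v * sinc (r * v))) volume ε 1 :=
    Continuous.intervalIntegrable (by fun_prop) _ _
  have h2 : IntervalIntegrable (fun r => cos v * (r / (4 - r ^ 2) * sin (r * v))) volume ε 1 :=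
    ContinuousOn.intervalIntegrable (by fun_prop (disch := assumption))
  have h3 : IntervalIntegrable (fun r => 2 * sin v * (1 / (4 - r ^ 2) * cos (r * v)))
      volume ε 1 := ContinuousOn.intervalIntegrable (by fun_prop (disch := assumption))
  have hscale : v * ∫ r in ε..1, sinc (r * v) =
      (∫ r in (0 : ℝ)..v, sinc r) - ∫ r in (0 : ℝ)..(ε * v), sinc r := by
    rw [intervalIntegral.integral_interval_sub_left (continuous_sinc.intervalIntegrable _ _)
      (continuous_sinc.intervalIntegrable _ _), intervalIntegral.mul_integral_comp_mul_right,
      one_mul]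
  simp only [foldedIntegrand]
  rw [intervalIntegral.integral_sub (h1.add h2) h3, intervalIntegral.integral_add h1 h2,
    intervalIntegral.integral_const_mul, intervalIntegral.integral_const_mul,
    intervalIntegral.integral_const_mul, intervalIntegral.integral_const_mul, hscale]

lemma abs_div_four_sub_sq_le {r : ℝ} (hr : r ∈ Icc (0 : ℝ) 1) : |r / (4 - r ^ 2)| ≤ 1 / 3 := by
  have hpos : 0 < 4 - r ^ 2 := by nlinarith [hr.1, hr.2]
  rw [abs_of_nonneg (div_nonneg hr.1 hpos.le), div_le_div_iff₀ hpos three_pos]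
  nlinarith [hr.1, hr.2]

lemma abs_one_div_four_sub_sq_le {r : ℝ} (hr : r ∈ Icc (0 : ℝ) 1) :
    |1 / (4 - r ^ 2)| ≤ 1 / 3 := by
  have hpos : 0 < 4 - r ^ 2 := by nlinarith [hr.1, hr.2]
  rw [abs_of_nonneg (div_nonneg zero_le_one hpos.le), div_le_div_iff₀ hpos three_pos]
  nlinarith [hr.1, hr.2]

lemma abs_integral_le_of_abs_le {F : ℝ → ℝ} {ε c : ℝ} (hε0 : 0 ≤ ε) (hε1 : ε ≤ 1) (hc : 0 ≤ c)
    (hF : ∀ r ∈ Icc (0 : ℝ) 1, |F r| ≤ c) : |∫ r in ε..1, F r| ≤ c := by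
  have h := intervalIntegral.norm_integral_le_of_norm_le_const (a := ε) (b := 1) (f := F) (C := c)
    (fun r hr => by
      rw [uIoc_of_le hε1] at hr
      exact hF r ⟨hε0.trans hr.1.le, hr.2⟩)
  rw [abs_of_nonneg (sub_nonneg.2 hε1)] at h
  exact h.trans (mul_le_of_le_one_right hc (by linarith))

lemma abs_integral_div_four_sub_sq_mul_sin_le {ε v : ℝ} (hε0 : 0 ≤ ε) (hε1 : ε ≤ 1) (hv : 0 < v) :
    |∫ r in ε..1, r / (4 - r ^ 2) * sin (r * v)| ≤ 4 / 3 / v := by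
  have hsub : Icc ε 1 ⊆ Icc (0 : ℝ) 1 := Icc_subset_Icc_left hε0
  have hne : ∀ r ∈ Icc ε 1, 4 - r ^ 2 ≠ 0 := fun r hr => by nlinarith [(hsub hr).1, hr.2]
  have h := abs_integral_mul_sin_le (φ := fun r => r / (4 - r ^ 2))
    (φ' := fun r => (4 + r ^ 2) / (4 - r ^ 2) ^ 2) (c := 0) hε1 hv
    (fun r hr => by
      have hd := (hasDerivAt_id r).div (((hasDerivAt_id r).pow 2).const_sub 4) (hne r hr)
      refine hd.congr_deriv ?_
      simp only [Pi.pow_apply, id]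
      congr 1
      push_cast
      ring)
    (by
      have hne' : ∀ r ∈ Icc ε 1, (4 - r ^ 2) ^ 2 ≠ 0 := fun r hr => pow_ne_zero 2 (hne r hr)
      fun_prop (disch := assumption))
    (fun r _ => by positivity)
  simp only [add_zero] at h
  refine h.trans ?_
  gcongr
  linarith [abs_div_four_sub_sq_le (hsub (left_mem_Icc.2 hε1)),
    abs_div_four_sub_sq_le (hsub (right_mem_Icc.2 hε1))]

lemma abs_integral_one_div_four_sub_sq_mul_cos_le {ε v : ℝ} (hε0 : 0 ≤ ε) (hε1 : ε ≤ 1)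
    (hv : 0 < v) : |∫ r in ε..1, 1 / (4 - r ^ 2) * cos (r * v)| ≤ 4 / 3 / v := by
  have hsub : Icc ε 1 ⊆ Icc (0 : ℝ) 1 := Icc_subset_Icc_left hε0
  have hne : ∀ r ∈ Icc ε 1, 4 - r ^ 2 ≠ 0 := fun r hr => by nlinarith [(hsub hr).1, hr.2]
  have h := abs_integral_mul_sin_le (φ := fun r => 1 / (4 - r ^ 2))
    (φ' := fun r => 2 * r / (4 - r ^ 2) ^ 2) (c := π / 2) hε1 hv
    (fun r hr => by
      have hd := (hasDerivAt_const r (1 : ℝ)).div (((hasDerivAt_id r).pow 2).const_sub 4) (hne r hr)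
      refine hd.congr_deriv ?_
      simp only [Pi.pow_apply, id]
      congr 1
      push_cast
      ring)
    (by
      have hne' : ∀ r ∈ Icc ε 1, (4 - r ^ 2) ^ 2 ≠ 0 := fun r hr => pow_ne_zero 2 (hne r hr)
      fun_prop (disch := assumption))
    (fun r hr => div_nonneg (mul_nonneg zero_le_two (hsub hr).1) (sq_nonneg _))
  simp only [sin_add_pi_div_two] at h
  refine h.trans ?_
  gcongr
  linarith [abs_one_div_four_sub_sq_le (hsub (left_mem_Icc.2 hε1)),
    abs_one_div_four_sub_sq_le (hsub (right_mem_Icc.2 hε1))]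

lemma abs_cos_mul_sub_two_sin_mul_le (v a b : ℝ) :
    |cos v * a - 2 * sin v * b| ≤ |a| + 2 * |b| := by
  refine (abs_sub _ _).trans (add_le_add ?_ ?_)
  · rw [abs_mul]
    exact mul_le_of_le_one_left (abs_nonneg _) (abs_cos_le_one v)
  · rw [abs_mul, abs_mul, abs_two, mul_assoc]
    gcongr
    exact mul_le_of_le_one_left (abs_nonneg _) (abs_sin_le_one v)

lemma Ioi_two_subset : Ioi (2 : ℝ) ⊆ {s : ℝ | 0 < s ∧ 1 / 2 < |s - 1|} := by
  intro s hs
  have hs' : 2 < s := hs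
  exact ⟨by linarith, lt_abs.2 (Or.inl (by linarith))⟩

lemma integrableOn_one_div_sq_sub_one_Ioi_two :
    IntegrableOn (fun s : ℝ => 1 / (s ^ 2 - 1)) (Ioi 2) := by
  simpa using (integrableOn_one_div_sq_sub_sq one_pos one_half_pos).mono_set Ioi_two_subset

lemma integrableOn_sin_div_sq_sub_one_Ioi_two (v : ℝ) :
    IntegrableOn (fun s : ℝ => sin (s * v) / (s ^ 2 - 1)) (Ioi 2) :=
  (integrableOn_sin_div_sq_sub_one one_half_pos v).mono_set Ioi_two_subset

lemma integrableOn_sqrt_div_sq_sub_one_Ioi_two :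
    IntegrableOn (fun s : ℝ => √s / (s ^ 2 - 1)) (Ioi 2) := by
  have hmaj : IntegrableOn (fun s : ℝ => 4 / 3 * s ^ (-(3 / 2) : ℝ)) (Ioi 2) :=
    (integrableOn_Ioi_rpow_of_lt (by norm_num) two_pos).const_mul _
  refine Integrable.mono' hmaj (Measurable.aestronglyMeasurable (by fun_prop)) ?_
  filter_upwards [ae_restrict_mem measurableSet_Ioi] with s hs
  have hs' : 2 < s := hs
  have hpos : 0 < s ^ 2 - 1 := by nlinarith
  have hs0 : 0 < s := by linarith
  rw [norm_eq_abs, abs_of_nonneg (div_nonneg (sqrt_nonneg s) hpos.le), div_le_iff₀ hpos,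
    sqrt_eq_rpow, show (1 / 2 : ℝ) = -(3 / 2) + 2 by norm_num, rpow_add hs0, rpow_two]
  have hcomp : s ^ 2 ≤ 4 / 3 * (s ^ 2 - 1) := by nlinarith
  nlinarith [mul_le_mul_of_nonneg_left hcomp (rpow_pos_of_pos hs0 (-(3 / 2))).le]

lemma abs_tailKernel_le_integral (v : ℝ) :
    |tailKernel v| ≤ ∫ s in Ioi (2 : ℝ), 1 / (s ^ 2 - 1) := by
  rw [tailKernel, ← norm_eq_abs]
  refine norm_integral_le_of_norm_le integrableOn_one_div_sq_sub_one_Ioi_two ?_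
  filter_upwards [ae_restrict_mem measurableSet_Ioi] with s hs
  have hs' : 2 < s := hs
  have hpos : 0 < s ^ 2 - 1 := by nlinarith
  rw [norm_div, norm_eq_abs, norm_eq_abs, abs_of_pos hpos]
  gcongr
  exact abs_sin_le_one _

lemma abs_sin_le_sqrt {y : ℝ} (hy : 0 ≤ y) : |sin y| ≤ √y := by
  refine abs_le_sqrt ?_
  rcases le_total y 1 with h | h
  · nlinarith [sq_le_sq.2 (abs_sin_le_abs (x := y))]
  · exact (sin_sq_le_one y).trans h

lemma abs_tailKernel_le_sqrt {v : ℝ} (hv : 0 ≤ v) :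
    |tailKernel v| ≤ (∫ s in Ioi (2 : ℝ), √s / (s ^ 2 - 1)) * √v := by
  rw [tailKernel, ← norm_eq_abs, ← integral_mul_const]
  refine norm_integral_le_of_norm_le (integrableOn_sqrt_div_sq_sub_one_Ioi_two.mul_const _) ?_
  filter_upwards [ae_restrict_mem measurableSet_Ioi] with s hs
  have hs' : 2 < s := hs
  have hpos : 0 < s ^ 2 - 1 := by nlinarith
  rw [norm_div, norm_eq_abs, norm_eq_abs, abs_of_pos hpos, div_mul_eq_mul_div,
    ← sqrt_mul (by linarith)]
  gcongr
  exact abs_sin_le_sqrt (mul_nonneg (by linarith) hv)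

lemma abs_tailKernel_le_inv {v : ℝ} (hv : 0 < v) : |tailKernel v| ≤ 4 / 3 / v := by
  have hlim := intervalIntegral_tendsto_integral_Ioi 2
    (integrableOn_sin_div_sq_sub_one_Ioi_two v) tendsto_id
  refine le_of_tendsto hlim.abs ?_
  filter_upwards [eventually_ge_atTop 2] with N hN
  have hpos : ∀ s ∈ Icc 2 N, 0 < s ^ 2 - 1 := fun s hs => by nlinarith [hs.1]
  have hne : ∀ s ∈ Icc 2 N, s ^ 2 - 1 ≠ 0 := fun s hs => (hpos s hs).ne'
  have h := abs_integral_mul_sin_le (φ := fun s => -1 / (s ^ 2 - 1))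
    (φ' := fun s => 2 * s / (s ^ 2 - 1) ^ 2) (c := 0) hN hv
    (fun s hs => by
      have hd := (hasDerivAt_const s (-1 : ℝ)).div (((hasDerivAt_id s).pow 2).sub_const 1) (hne s hs)
      refine hd.congr_deriv ?_
      simp only [Pi.pow_apply, id]
      congr 1
      push_cast
      ring)
    (by
      have hne' : ∀ s ∈ Icc 2 N, (s ^ 2 - 1) ^ 2 ≠ 0 := fun s hs => pow_ne_zero 2 (hne s hs)
      fun_prop (disch := assumption))
    (fun s hs => div_nonneg (by linarith [hs.1]) (sq_nonneg _))
  have hamp : ∀ s ∈ Icc 2 N, |-1 / (s ^ 2 - 1)| ≤ 1 / 3 := fun s hs => by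
    rw [abs_div, abs_neg, abs_one, abs_of_pos (hpos s hs)]
    exact one_div_le_one_div_of_le three_pos (by nlinarith [hs.1])
  have hneg : ∫ s in (2 : ℝ)..N, -1 / (s ^ 2 - 1) * sin (s * v + 0) =
      -∫ s in (2 : ℝ)..N, sin (s * v) / (s ^ 2 - 1) := by
    rw [← intervalIntegral.integral_neg]
    congr 1 with s
    rw [add_zero]
    ring
  rw [hneg, abs_neg] at h
  refine h.trans ?_
  gcongr
  linarith [hamp 2 (left_mem_Icc.2 hN), hamp N (right_mem_Icc.2 hN)]

lemma abs_truncatedKernel_le {ε v : ℝ} (hε0 : 0 < ε) (hε1 : ε < 1) (hv : 0 ≤ v) :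
    |truncatedKernel ε v| ≤ 7 + ∫ s in Ioi (2 : ℝ), 1 / (s ^ 2 - 1) := by
  have h1 : |∫ r in ε..1, r / (4 - r ^ 2) * sin (r * v)| ≤ 1 / 3 :=
    abs_integral_le_of_abs_le hε0.le hε1.le (by norm_num) fun r hr => by
      rw [abs_mul]
      exact (mul_le_of_le_one_right (abs_nonneg _) (abs_sin_le_one _)).trans
        (abs_div_four_sub_sq_le hr)
  have h2 : |∫ r in ε..1, 1 / (4 - r ^ 2) * cos (r * v)| ≤ 1 / 3 :=
    abs_integral_le_of_abs_le hε0.le hε1.le (by norm_num) fun r hr => by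
      rw [abs_mul]
      exact (mul_le_of_le_one_right (abs_nonneg _) (abs_cos_le_one _)).trans
        (abs_one_div_four_sub_sq_le hr)
  have h3 : |cos v * ((∫ r in (0 : ℝ)..v, sinc r) - ∫ r in (0 : ℝ)..(ε * v), sinc r)| ≤ 6 := by
    rw [abs_mul]
    refine (mul_le_of_le_one_left (abs_nonneg _) (abs_cos_le_one v)).trans ?_
    refine (abs_sub _ _).trans ?_
    linarith [abs_integral_sinc_le hv, abs_integral_sinc_le (mul_nonneg hε0.le hv)]
  rw [truncatedKernel_eq hε0 hε1, integral_foldedIntegrand_eq hε0.le hε1.le, add_sub_assoc]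
  refine (abs_add_le _ _).trans (add_le_add ((abs_add_le _ _).trans ?_)
    (abs_tailKernel_le_integral v))
  linarith [abs_cos_mul_sub_two_sin_mul_le v (∫ r in ε..1, r / (4 - r ^ 2) * sin (r * v))
    (∫ r in ε..1, 1 / (4 - r ^ 2) * cos (r * v))]

lemma abs_principalKernel_sub_le {v : ℝ} (hv : 0 < v) :
    |principalKernel v - π / 2 * cos v| ≤ 7 / v := by
  have h3 : |cos v * ((∫ r in (0 : ℝ)..v, sinc r) - π / 2)| ≤ 1 / v := by
    rw [abs_mul]
    exact (mul_le_of_le_one_left (abs_nonneg _) (abs_cos_le_one v)).trans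
      (abs_integral_sinc_sub_pi_div_two_le hv)
  have h := abs_cos_mul_sub_two_sin_mul_le v
    (∫ r in (0 : ℝ)..1, r / (4 - r ^ 2) * sin (r * v))
    (∫ r in (0 : ℝ)..1, 1 / (4 - r ^ 2) * cos (r * v))
  rw [principalKernel, integral_foldedIntegrand_eq le_rfl zero_le_one, zero_mul,
    intervalIntegral.integral_same, sub_zero]
  set J₁ := ∫ r in (0 : ℝ)..1, r / (4 - r ^ 2) * sin (r * v) with hJ₁
  set J₂ := ∫ r in (0 : ℝ)..1, 1 / (4 - r ^ 2) * cos (r * v) with hJ₂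
  calc _ = |cos v * ((∫ r in (0 : ℝ)..v, sinc r) - π / 2) + (cos v * J₁ - 2 * sin v * J₂)
        + tailKernel v| := by ring_nf
    _ ≤ 1 / v + (4 / 3 / v + 2 * (4 / 3 / v)) + 4 / 3 / v := by
        refine (abs_add_le _ _).trans (add_le_add ((abs_add_le _ _).trans
          (add_le_add h3 (h.trans ?_))) (abs_tailKernel_le_inv hv))
        linarith [abs_integral_div_four_sub_sq_mul_sin_le le_rfl zero_le_one hv,
          abs_integral_one_div_four_sub_sq_mul_cos_le le_rfl zero_le_one hv]
    _ = 19 / 3 / v := by ring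
    _ ≤ 7 / v := by gcongr; norm_num

lemma abs_principalKernel_le {v : ℝ} (hv : 0 ≤ v) :
    |principalKernel v| ≤ 2 * v + (∫ s in Ioi (2 : ℝ), √s / (s ^ 2 - 1)) * √v := by
  refine (abs_add_le _ _).trans (add_le_add ?_ (abs_tailKernel_le_sqrt hv))
  refine abs_integral_le_of_abs_le le_rfl zero_le_one (by linarith) fun r hr => ?_
  have hsin : ∀ y : ℝ, 0 ≤ y → |sin y| ≤ y := fun y hy =>
    abs_sin_le_abs.trans_eq (abs_of_nonneg hy)
  have hrv : |sin (r * v)| ≤ v :=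
    (hsin _ (mul_nonneg hr.1 hv)).trans (mul_le_of_le_one_left hv hr.2)
  have h1 : |cos v * (v * sinc (r * v))| ≤ v := by
    rw [abs_mul, abs_mul, abs_of_nonneg hv]
    exact (mul_le_of_le_one_left (by positivity) (abs_cos_le_one v)).trans
      (mul_le_of_le_one_right hv (abs_sinc_le_one _))
  have h2 : |cos v * (r / (4 - r ^ 2) * sin (r * v))| ≤ 1 / 3 * v := by
    rw [abs_mul, abs_mul]
    refine (mul_le_of_le_one_left (by positivity) (abs_cos_le_one v)).trans ?_
    gcongr
    exact abs_div_four_sub_sq_le hr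
  have h3 : |2 * sin v * (1 / (4 - r ^ 2) * cos (r * v))| ≤ 2 * v * (1 / 3 * 1) := by
    rw [abs_mul, abs_mul, abs_two, abs_mul]
    gcongr
    · exact hsin v hv
    · exact abs_one_div_four_sub_sq_le hr
    · exact abs_cos_le_one _
  refine (abs_sub _ _).trans ?_
  linarith [abs_add_le (cos v * (v * sinc (r * v))) (cos v * (r / (4 - r ^ 2) * sin (r * v)))]

lemma measurable_principalKernel : Measurable principalKernel := by
  have hfold : StronglyMeasurable (Function.uncurry foldedIntegrand) := by
    have hsinc : Measurable sinc := continuous_sinc.measurable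
    refine Measurable.stronglyMeasurable ?_
    unfold foldedIntegrand
    simp only [Function.uncurry_def]
    fun_prop
  have htail : StronglyMeasurable
      (Function.uncurry fun v s : ℝ => sin (s * v) / (s ^ 2 - 1)) := by
    refine Measurable.stronglyMeasurable ?_
    simp only [Function.uncurry_def]
    fun_prop
  have h1 := (hfold.integral_prod_right (ν := volume.restrict (Ioc 0 1))).measurable
  have h2 := (htail.integral_prod_right (ν := volume.restrict (Ioi 2))).measurable
  unfold principalKernel tailKernel
  simp only [intervalIntegral.integral_of_le zero_le_one]
  exact h1.add h2

/-- The difference between the kernels of the tail integral and of the Hilbert transform. -/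
noncomputable def kernelError (v : ℝ) : ℝ :=
  (if π / 2 < v then cos v else 0) - 2 / π * principalKernel v

lemma measurable_kernelError : Measurable kernelError :=
  (Measurable.ite measurableSet_Ioi measurable_cos measurable_const).sub
    (measurable_principalKernel.const_mul _)

lemma integrableOn_kernelError_div : IntegrableOn (fun v => kernelError v / v) (Ioi 0) := by
  have hmeas : Measurable fun v => kernelError v / v := measurable_kernelError.div measurable_id
  have hpi : 2 / π ≤ 1 := by
    rw [div_le_one pi_pos]
    exact two_le_pi
  have hpi0 : 0 < 2 / π := div_pos two_pos pi_pos
  rw [← Ioc_union_Ioi_eq_Ioi (div_pos pi_pos two_pos).le]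
  refine IntegrableOn.union ?_ ?_
  · set c := ∫ s in Ioi (2 : ℝ), √s / (s ^ 2 - 1) with hc
    have hmaj : IntegrableOn (fun v : ℝ => 2 + c * v ^ (-(1 / 2) : ℝ)) (Ioc 0 (π / 2)) := by
      have hpow := intervalIntegral.intervalIntegrable_rpow' (a := 0) (b := π / 2)
        (show (-1 : ℝ) < -(1 / 2) by norm_num)
      rw [intervalIntegrable_iff_integrableOn_Ioc_of_le (div_pos pi_pos two_pos).le] at hpow
      exact (integrableOn_const (by simp)).add (hpow.const_mul c)
    refine Integrable.mono' hmaj hmeas.aestronglyMeasurable ?_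
    filter_upwards [ae_restrict_mem measurableSet_Ioc] with v hv
    have hk : |kernelError v| ≤ 2 * v + c * √v := by
      rw [kernelError, if_neg (not_lt.2 hv.2), zero_sub, abs_neg, abs_mul, abs_of_pos hpi0]
      exact (mul_le_of_le_one_left (abs_nonneg _) hpi).trans (abs_principalKernel_le hv.1.le)
    rw [norm_eq_abs, abs_div, abs_of_pos hv.1, div_le_iff₀ hv.1, add_mul, mul_assoc c,
      ← rpow_add_one hv.1.ne']
    norm_num
    rwa [sqrt_eq_rpow] at hk
  · have hmaj : IntegrableOn (fun v : ℝ => 7 * v ^ (-2 : ℝ)) (Ioi (π / 2)) :=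
      (integrableOn_Ioi_rpow_of_lt (by norm_num) (div_pos pi_pos two_pos)).const_mul _
    refine Integrable.mono' hmaj hmeas.aestronglyMeasurable ?_
    filter_upwards [ae_restrict_mem measurableSet_Ioi] with v hv
    have hv0 : 0 < v := (div_pos pi_pos two_pos).trans hv
    have hk : |kernelError v| ≤ 7 / v := by
      rw [kernelError, if_pos (mem_Ioi.1 hv),
        show cos v - 2 / π * principalKernel v =
          -(2 / π * (principalKernel v - π / 2 * cos v)) by field_simp; ring,
        abs_neg, abs_mul, abs_of_pos hpi0]
      exact (mul_le_of_le_one_left (abs_nonneg _) hpi).trans (abs_principalKernel_sub_le hv0)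
    rw [norm_eq_abs, abs_div, abs_of_pos hv0, rpow_neg hv0.le, rpow_two]
    calc |kernelError v| / v ≤ 7 / v / v := by gcongr
      _ = 7 * (v ^ 2)⁻¹ := by field_simp

open scoped Pointwise in
lemma integral_sin_div_sq_sub_sq_eq {x δ : ℝ} (hx : 0 < x) (u : ℝ) :
    ∫ t in {t : ℝ | 0 < t ∧ δ < |t - x|}, sin (t * u) / (t ^ 2 - x ^ 2) =
      x⁻¹ * truncatedKernel (δ / x) (x * u) := by
  have hset : {t : ℝ | 0 < t ∧ δ < |t - x|} = x • {s : ℝ | 0 < s ∧ δ / x < |s - 1|} := by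
    ext t
    rw [mem_smul_set_iff_inv_smul_mem₀ hx.ne']
    simp only [mem_ofPred_eq, smul_eq_mul]
    refine and_congr (by rw [mul_pos_iff_of_pos_left (inv_pos.2 hx)]) ?_
    rw [show x⁻¹ * t - 1 = (t - x) / x by field_simp, abs_div, abs_of_pos hx,
      div_lt_div_iff_of_pos_right hx]
  have h := Measure.setIntegral_comp_smul_of_pos volume
    (fun t : ℝ => sin (t * u) / (t ^ 2 - x ^ 2)) {s : ℝ | 0 < s ∧ δ / x < |s - 1|} hx
  rw [← hset, Module.finrank_self, pow_one, smul_eq_mul] at h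
  have hcomp : ∀ s : ℝ, sin (x • s * u) / ((x • s) ^ 2 - x ^ 2) =
      (x ^ 2)⁻¹ * (sin (s * (x * u)) / (s ^ 2 - 1)) := fun s => by
    rw [smul_eq_mul, show (x * s) ^ 2 - x ^ 2 = x ^ 2 * (s ^ 2 - 1) by ring,
      show x * s * u = s * (x * u) by ring, div_mul_eq_div_div, div_eq_mul_inv _ (x ^ 2)]
    ring
  simp only [hcomp] at h
  rw [integral_const_mul, ← truncatedKernel] at h
  field_simp at h ⊢
  linarith

lemma integral_sine_transform_div_eq {f' : ℝ → ℂ} (hf' : IntegrableOn f' (Ioi 0)) {x δ : ℝ}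
    (hx : 0 < x) (hδ : 0 < δ) :
    ∫ t in {t : ℝ | 0 < t ∧ δ < |t - x|},
      (t : ℂ) * ((∫ u in Ioi (0 : ℝ), f' u * (sin (t * u) : ℂ)) / (t : ℂ)) /
        ((t : ℂ) ^ 2 - (x : ℂ) ^ 2) =
      ∫ u in Ioi (0 : ℝ), f' u * ((x⁻¹ * truncatedKernel (δ / x) (x * u) : ℝ) : ℂ) := by
  have hpoint : ∀ t ∈ {t : ℝ | 0 < t ∧ δ < |t - x|},
      (t : ℂ) * ((∫ u in Ioi (0 : ℝ), f' u * (sin (t * u) : ℂ)) / (t : ℂ)) /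
        ((t : ℂ) ^ 2 - (x : ℂ) ^ 2) =
      ∫ u in Ioi (0 : ℝ), f' u * ((sin (t * u) / (t ^ 2 - x ^ 2) : ℝ) : ℂ) := by
    intro t ht
    have ht0 : (t : ℂ) ≠ 0 := Complex.ofReal_ne_zero.2 ht.1.ne'
    rw [mul_div_cancel₀ _ ht0, ← integral_div]
    congr 1 with u
    push_cast
    ring
  have hprod : Integrable (Function.uncurry fun t u : ℝ =>
      f' u * ((sin (t * u) / (t ^ 2 - x ^ 2) : ℝ) : ℂ))
      ((volume.restrict {t : ℝ | 0 < t ∧ δ < |t - x|}).prod (volume.restrict (Ioi 0))) := by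
    have hmul := (integrableOn_one_div_sq_sub_sq hx hδ).ofReal (𝕜 := ℂ) |>.mul_prod hf'
    refine hmul.mono ?_ (Eventually.of_forall fun p => ?_)
    · refine hf'.aestronglyMeasurable.comp_snd.mul (Measurable.aestronglyMeasurable ?_)
      fun_prop
    · simp only [Function.uncurry_def, norm_mul, RCLike.norm_ofReal, Complex.norm_real, norm_eq_abs,
        abs_div, abs_one]
      rw [mul_comm]
      gcongr
      exact abs_sin_le_one _
  rw [setIntegral_congr_fun (measurableSet_setOf_pos_and_lt_abs_sub x δ) hpoint,
    integral_integral_swap hprod]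
  congr 1 with u
  rw [integral_const_mul, ← integral_sin_div_sq_sub_sq_eq hx, integral_complex_ofReal]

/-- The principal value of the Hilbert transform is integration against the principal kernel. -/
lemma tendsto_hilbert_sine_transform {f' : ℝ → ℂ} (hf' : IntegrableOn f' (Ioi 0)) {x : ℝ}
    (hx : 0 < x) :
    Tendsto (fun δ : ℝ => ((2 / π : ℝ) : ℂ) * ∫ t in {t : ℝ | 0 < t ∧ δ < |t - x|},
      (t : ℂ) * ((∫ u in Ioi (0 : ℝ), f' u * (sin (t * u) : ℂ)) / (t : ℂ)) /
        ((t : ℂ) ^ 2 - (x : ℂ) ^ 2)) (nhdsWithin 0 (Ioi 0))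
      (nhds (((2 / π : ℝ) : ℂ) *
        ∫ u in Ioi (0 : ℝ), f' u * ((x⁻¹ * principalKernel (x * u) : ℝ) : ℂ))) := by
  set B := 7 + ∫ s in Ioi (2 : ℝ), 1 / (s ^ 2 - 1) with hB
  have hscale : Tendsto (fun δ : ℝ => δ / x) (nhdsWithin 0 (Ioi 0)) (nhdsWithin 0 (Ioi 0)) := by
    refine tendsto_nhdsWithin_iff.2 ⟨?_, ?_⟩
    · have h : Tendsto (fun δ : ℝ => δ / x) (nhds 0) (nhds (0 / x)) := tendsto_id.div_const x
      rw [zero_div] at h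
      exact h.mono_left nhdsWithin_le_nhds
    · filter_upwards [self_mem_nhdsWithin] with δ hδ
      exact div_pos hδ hx
  have htrunc : ∀ ε : ℝ, Measurable (truncatedKernel ε) := by
    intro ε
    have hsm : StronglyMeasurable
        (Function.uncurry fun v s : ℝ => sin (s * v) / (s ^ 2 - 1)) := by
      refine Measurable.stronglyMeasurable ?_
      simp only [Function.uncurry_def]
      fun_prop
    exact (hsm.integral_prod_right
      (ν := volume.restrict {s : ℝ | 0 < s ∧ ε < |s - 1|})).measurable
  have hdom : Tendsto (fun δ : ℝ =>
      ∫ u in Ioi (0 : ℝ), f' u * ((x⁻¹ * truncatedKernel (δ / x) (x * u) : ℝ) : ℂ))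
      (nhdsWithin 0 (Ioi 0))
      (nhds (∫ u in Ioi (0 : ℝ), f' u * ((x⁻¹ * principalKernel (x * u) : ℝ) : ℂ))) := by
    refine tendsto_integral_filter_of_dominated_convergence (fun u => ‖f' u‖ * (x⁻¹ * B))
      ?_ ?_ (hf'.norm.mul_const _) ?_
    · refine Eventually.of_forall fun δ => ?_
      refine hf'.aestronglyMeasurable.mul (Measurable.aestronglyMeasurable ?_)
      exact Complex.measurable_ofReal.comp
        (((htrunc (δ / x)).comp (measurable_const_mul x)).const_mul x⁻¹)
    · filter_upwards [Ioo_mem_nhdsGT hx] with δ hδ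
      filter_upwards [ae_restrict_mem measurableSet_Ioi] with u hu
      rw [norm_mul, Complex.norm_real, norm_mul, norm_eq_abs, abs_of_pos (inv_pos.2 hx),
        norm_eq_abs]
      gcongr
      exact abs_truncatedKernel_le (div_pos hδ.1 hx) ((div_lt_one hx).2 hδ.2)
        (mul_nonneg hx.le (le_of_lt hu))
    · refine Eventually.of_forall fun u => Tendsto.const_mul _ ?_
      refine (Complex.continuous_ofReal.tendsto _).comp (Tendsto.const_mul _ ?_)
      exact (tendsto_truncatedKernel (x * u)).comp hscale
  refine (hdom.const_mul _).congr' ?_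
  filter_upwards [self_mem_nhdsWithin] with δ hδ
  rw [integral_sine_transform_div_eq hf' hx hδ]

/-- Integration by parts for the tail integral, started at a zero of the cosine. -/
lemma integral_mul_sin_eq {f f' : ℝ → ℂ} {a N x : ℝ} (hx : 0 < x) (haN : a ≤ N)
    (hcos : cos (x * a) = 0) (hf' : IntegrableOn f' (Ioc a N))
    (hf : ∀ t ∈ Ioc a N, f N - f t = ∫ u in t..N, f' u) :
    ∫ t in a..N, f t * (sin (x * t) : ℂ) =
      (∫ u in a..N, f' u * ((x⁻¹ * cos (x * u) : ℝ) : ℂ)) -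
        f N * ((x⁻¹ * cos (x * N) : ℝ) : ℂ) := by
  have hsin : ∀ u, ∫ t in a..u, (sin (x * t) : ℂ) = ((-(x⁻¹ * cos (x * u)) : ℝ) : ℂ) := by
    intro u
    rw [intervalIntegral.integral_ofReal, intervalIntegral.integral_comp_mul_left _ hx.ne',
      integral_sin, hcos, smul_eq_mul]
    congr 1
    ring
  have hprod : Integrable (Function.uncurry fun t u : ℝ =>
      (Ioc t N).indicator f' u * (sin (x * t) : ℂ))
      ((volume.restrict (Ioc a N)).prod (volume.restrict (Ioc a N))) := by
    have hsinint : Integrable (fun t : ℝ => (sin (x * t) : ℂ)) (volume.restrict (Ioc a N)) :=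
      (Continuous.integrableOn_Icc (by fun_prop)).mono_set Ioc_subset_Icc_self
    have hset : MeasurableSet {p : ℝ × ℝ | p.1 < p.2 ∧ p.2 ≤ N} :=
      (measurableSet_lt measurable_fst measurable_snd).inter
        (measurableSet_le measurable_snd measurable_const)
    refine ((hsinint.mul_prod hf').indicator hset).congr (Eventually.of_forall fun p => ?_)
    by_cases hp : p.1 < p.2 ∧ p.2 ≤ N
    · simp [Function.uncurry_def, indicator, hp, mul_comm]
    · simp [Function.uncurry_def, indicator, hp]
  have hinner : ∀ t ∈ Ioc a N, ∫ u in Ioc a N, (Ioc t N).indicator f' u * (sin (x * t) : ℂ) =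
      (f N - f t) * (sin (x * t) : ℂ) := by
    intro t ht
    rw [integral_mul_const, setIntegral_indicator measurableSet_Ioc,
      inter_eq_self_of_subset_right (Ioc_subset_Ioc_left ht.1.le), hf t ht,
      intervalIntegral.integral_of_le ht.2]
  have houter : ∀ u ∈ Ioc a N, ∫ t in Ioc a N, (Ioc t N).indicator f' u * (sin (x * t) : ℂ) =
      f' u * ((-(x⁻¹ * cos (x * u)) : ℝ) : ℂ) := by
    intro u hu
    rw [← hsin u, intervalIntegral.integral_of_le hu.1.le, ← integral_const_mul,
      integral_Ioc_eq_integral_Ioo, integral_Ioc_eq_integral_Ioo,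
      ← inter_eq_self_of_subset_right (Ioo_subset_Ioo_right hu.2),
      ← setIntegral_indicator measurableSet_Ioo]
    refine setIntegral_congr_fun measurableSet_Ioo fun t ht => ?_
    by_cases htu : t < u
    · simp [indicator, htu, hu.2, ht.1]
    · simp [indicator, htu]
  have hswap := integral_integral_swap hprod
  rw [setIntegral_congr_fun measurableSet_Ioc hinner,
    setIntegral_congr_fun measurableSet_Ioc houter, ← intervalIntegral.integral_of_le haN,
    ← intervalIntegral.integral_of_le haN] at hswap
  have hdiff : IntervalIntegrable (fun t => (f N - f t) * (sin (x * t) : ℂ)) volume a N := by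
    rw [intervalIntegrable_iff_integrableOn_Ioc_of_le haN]
    refine Integrable.congr hprod.integral_prod_left ?_
    filter_upwards [ae_restrict_mem measurableSet_Ioc] with t ht
    exact hinner t ht
  have hconst : IntervalIntegrable (fun t => f N * (sin (x * t) : ℂ)) volume a N :=
    Continuous.intervalIntegrable (by fun_prop) _ _
  calc ∫ t in a..N, f t * (sin (x * t) : ℂ)
      = ∫ t in a..N, (f N * (sin (x * t) : ℂ) - (f N - f t) * (sin (x * t) : ℂ)) := by
        congr 1 with t
        ring
    _ = f N * ((-(x⁻¹ * cos (x * N)) : ℝ) : ℂ) -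
          ∫ u in a..N, f' u * ((-(x⁻¹ * cos (x * u)) : ℝ) : ℂ) := by
        rw [intervalIntegral.integral_sub hconst hdiff, intervalIntegral.integral_const_mul, hsin,
          hswap]
    _ = _ := by
        simp only [Complex.ofReal_neg, mul_neg, intervalIntegral.integral_neg]
        ring

lemma integrableOn_mul_ofReal_of_abs_le {f' : ℝ → ℂ} {φ : ℝ → ℝ} {s : Set ℝ} {c : ℝ}
    (hs : MeasurableSet s) (hf' : IntegrableOn f' s) (hφ : Measurable φ)
    (hbound : ∀ u ∈ s, |φ u| ≤ c) :
    IntegrableOn (fun u => f' u * (φ u : ℂ)) s := by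
  refine Integrable.mul_bdd (c := c) hf'
    (Complex.measurable_ofReal.comp hφ).aestronglyMeasurable ?_
  filter_upwards [ae_restrict_mem hs] with u hu
  simpa using hbound u hu

/-- The tail integral of `f` is the integral of its derivative against a truncated cosine. -/
lemma tail_integral_eq {f f' : ℝ → ℂ} {x : ℝ} {Ix : ℂ} (hx : 0 < x)
    (hf : ∀ a b : ℝ, 0 < a → a ≤ b → f b - f a = ∫ t in a..b, f' t)
    (hlim : Tendsto f atTop (nhds 0)) (hf' : IntegrableOn f' (Ioi 0))
    (hI : Tendsto (fun N : ℝ => ∫ t in (π / (2 * x))..N, f t * (sin (x * t) : ℂ)) atTop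
      (nhds Ix)) :
    Ix = ∫ u in Ioi (0 : ℝ),
      f' u * ((x⁻¹ * (if π / 2 < x * u then cos (x * u) else 0) : ℝ) : ℂ) := by
  set a := π / (2 * x) with ha
  have ha0 : 0 < a := by positivity
  have hxa : x * a = π / 2 := by
    rw [ha]
    field_simp
  have hcosbound : ∀ u : ℝ, |x⁻¹ * cos (x * u)| ≤ x⁻¹ := fun u => by
    rw [abs_mul, abs_of_pos (inv_pos.2 hx)]
    exact mul_le_of_le_one_right (inv_pos.2 hx).le (abs_cos_le_one _)
  have hf'a : IntegrableOn f' (Ioi a) := hf'.mono_set (Ioi_subset_Ioi ha0.le)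
  have hint : IntegrableOn (fun u => f' u * ((x⁻¹ * cos (x * u) : ℝ) : ℂ)) (Ioi a) :=
    integrableOn_mul_ofReal_of_abs_le measurableSet_Ioi hf'a (by fun_prop)
      fun u _ => hcosbound u
  have hboundary : Tendsto (fun N => f N * ((x⁻¹ * cos (x * N) : ℝ) : ℂ)) atTop (nhds 0) := by
    refine squeeze_zero_norm (a := fun N => ‖f N‖ * x⁻¹) (fun N => ?_) ?_
    · rw [norm_mul, Complex.norm_real]
      gcongr
      exact hcosbound N
    · simpa using hlim.norm.mul_const x⁻¹
  have hmain := (intervalIntegral_tendsto_integral_Ioi a hint tendsto_id).sub hboundary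
  rw [sub_zero] at hmain
  have hI' : Ix = ∫ u in Ioi a, f' u * ((x⁻¹ * cos (x * u) : ℝ) : ℂ) := by
    refine tendsto_nhds_unique hI (hmain.congr' ?_)
    filter_upwards [eventually_ge_atTop a] with N hN
    exact (integral_mul_sin_eq hx hN (by rw [hxa, cos_pi_div_two])
      (hf'a.mono_set Ioc_subset_Ioi_self)
      fun t ht => hf t N (ha0.trans ht.1) ht.2).symm
  rw [hI', ← inter_eq_self_of_subset_right (Ioi_subset_Ioi ha0.le),
    ← setIntegral_indicator measurableSet_Ioi]
  refine setIntegral_congr_fun measurableSet_Ioi fun u _ => ?_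
  have hiff : π / 2 < x * u ↔ u ∈ Ioi a := by rw [← hxa, mul_lt_mul_iff_right₀ hx, mem_Ioi]
  by_cases hu : u ∈ Ioi a
  · simp [hiff, hu]
  · simp [hiff, hu]

/-- Integration against a dilation-homogeneous kernel `x⁻¹ k (x u)` maps `L¹` to `L¹`. -/
lemma integrableOn_and_integral_norm_dilation_le {g : ℝ → ℂ} {k : ℝ → ℝ} (hk : Measurable k)
    (hkint : IntegrableOn (fun v => k v / v) (Ioi 0)) (hg : IntegrableOn g (Ioi 0)) :
    IntegrableOn (fun x => ∫ u in Ioi (0 : ℝ), g u * ((x⁻¹ * k (x * u) : ℝ) : ℂ)) (Ioi 0) ∧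
      ∫ x in Ioi (0 : ℝ), ‖∫ u in Ioi (0 : ℝ), g u * ((x⁻¹ * k (x * u) : ℝ) : ℂ)‖ ≤
        (∫ v in Ioi (0 : ℝ), |k v / v|) * ∫ u in Ioi (0 : ℝ), ‖g u‖ := by
  have hrescale : ∀ u : ℝ, 0 < u → ∀ x, x⁻¹ * k (x * u) = u * (k (x * u) / (x * u)) := by
    intro u hu x
    rw [div_eq_mul_inv, mul_inv]
    field_simp
  have hslice : ∀ u ∈ Ioi (0 : ℝ),
      IntegrableOn (fun x => g u * ((x⁻¹ * k (x * u) : ℝ) : ℂ)) (Ioi 0) := by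
    intro u hu
    have h := (integrableOn_Ioi_comp_mul_right_iff (fun v => k v / v) 0 hu).2
      (by rwa [zero_mul])
    simp only [hrescale u hu]
    exact ((h.const_mul u).ofReal (𝕜 := ℂ)).const_mul (g u)
  have hnorm : ∀ u ∈ Ioi (0 : ℝ), ∫ x in Ioi (0 : ℝ), ‖g u * ((x⁻¹ * k (x * u) : ℝ) : ℂ)‖ =
      ‖g u‖ * ∫ v in Ioi (0 : ℝ), |k v / v| := by
    intro u hu
    have h := integral_comp_mul_right_Ioi' (fun v => |k v / v|) 0 (mem_Ioi.1 hu)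
    rw [zero_mul, smul_eq_mul, ← integral_const_mul] at h
    rw [← h, ← integral_const_mul]
    congr 1 with x
    rw [norm_mul, Complex.norm_real, hrescale u hu, norm_mul, norm_eq_abs, norm_eq_abs,
      abs_of_pos (mem_Ioi.1 hu)]
  have hprod : Integrable (Function.uncurry fun u x : ℝ => g u * ((x⁻¹ * k (x * u) : ℝ) : ℂ))
      ((volume.restrict (Ioi 0)).prod (volume.restrict (Ioi 0))) := by
    refine (integrable_prod_iff ?_).2 ⟨?_, ?_⟩
    · refine hg.aestronglyMeasurable.comp_fst.mul (Measurable.aestronglyMeasurable ?_)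
      fun_prop
    · filter_upwards [ae_restrict_mem measurableSet_Ioi] with u hu
      exact hslice u hu
    · refine Integrable.congr (hg.norm.mul_const (∫ v in Ioi (0 : ℝ), |k v / v|)) ?_
      filter_upwards [ae_restrict_mem measurableSet_Ioi] with u hu
      exact (hnorm u hu).symm
  refine ⟨hprod.integral_prod_right, ?_⟩
  calc ∫ x in Ioi (0 : ℝ), ‖∫ u in Ioi (0 : ℝ), g u * ((x⁻¹ * k (x * u) : ℝ) : ℂ)‖
      ≤ ∫ x in Ioi (0 : ℝ), ∫ u in Ioi (0 : ℝ), ‖g u * ((x⁻¹ * k (x * u) : ℝ) : ℂ)‖ :=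
        integral_mono hprod.integral_prod_right.norm hprod.norm.integral_prod_right
          fun x => norm_integral_le_integral_norm _
    _ = ∫ u in Ioi (0 : ℝ), ‖g u‖ * ∫ v in Ioi (0 : ℝ), |k v / v| := by
        rw [← setIntegral_congr_fun measurableSet_Ioi hnorm]
        exact (integral_integral_swap hprod.norm).symm
    _ = _ := by rw [integral_mul_const, mul_comm]

lemma abs_principalKernel_le_const {v : ℝ} (hv : 0 ≤ v) :
    |principalKernel v| ≤ 7 + ∫ s in Ioi (2 : ℝ), 1 / (s ^ 2 - 1) := by
  refine le_of_tendsto (tendsto_truncatedKernel v).abs ?_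
  filter_upwards [Ioo_mem_nhdsGT zero_lt_one] with ε hε
  exact abs_truncatedKernel_le hε.1 hε.2 hv

/-- **The tail integral and the Hilbert transform.** If `f : (0,∞) → ℂ` is locally
absolutely continuous (with derivative `f'`), of bounded variation, and tends to `0`
at infinity (so `f'` is integrable on `(0,∞)`), and
`I(x) = ∫_{π/(2x)}^∞ f(t) sin(xt) dt` (improper integral), then
`I(x) = H₀(T_{f'})(x) + G(x)` for every `x > 0`, where
`‖G‖_{L¹(0,∞)} ≤ C ‖f'‖_{L¹(0,∞)}` for an absolute constant `C > 0`. -/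
theorem tail_integral_eq_hilbert_of_T_plus_good :
    ∃ C : ℝ, 0 < C ∧
      ∀ (f f' I H0T : ℝ → ℂ),
        -- local absolute continuity on (0,∞) with derivative f'
        (∀ a b : ℝ, 0 < a → a ≤ b → f b - f a = ∫ t in a..b, f' t) →
        -- bounded variation on (0,∞)
        BoundedVariationOn f (Set.Ioi 0) →
        -- vanishing at infinity
        Filter.Tendsto f Filter.atTop (nhds 0) →
        -- f' is Lebesgue integrable on (0,∞)
        MeasureTheory.IntegrableOn f' (Set.Ioi 0) →
        -- I is the (improper) tail integral I(x) = ∫_{π/(2x)}^∞ f(t) sin(xt) dt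
        (∀ x : ℝ, 0 < x →
          Filter.Tendsto
            (fun N : ℝ => ∫ t in (Real.pi / (2 * x))..N, f t * (Real.sin (x * t) : ℂ))
            Filter.atTop (nhds (I x))) →
        -- H0T is the odd Hilbert transform (principal value) of T_{f'}(u) = f̂'_s(u)/u
        (∀ x : ℝ, 0 < x →
          Filter.Tendsto (fun δ : ℝ =>
              ((2 / Real.pi : ℝ) : ℂ) *
                ∫ t in {t : ℝ | 0 < t ∧ δ < |t - x|},
                  (t : ℂ) *
                      ((∫ u in Set.Ioi (0 : ℝ), f' u * (Real.sin (t * u) : ℂ)) / (t : ℂ)) /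
                    ((t : ℂ) ^ 2 - (x : ℂ) ^ 2))
            (nhdsWithin 0 (Set.Ioi 0)) (nhds (H0T x))) →
        ∃ G : ℝ → ℂ,
          (∀ x : ℝ, 0 < x → I x = H0T x + G x) ∧
          MeasureTheory.IntegrableOn G (Set.Ioi 0) ∧
          (∫ x in Set.Ioi (0 : ℝ), ‖G x‖) ≤ C * ∫ t in Set.Ioi (0 : ℝ), ‖f' t‖ := by
  set c := ∫ v in Ioi (0 : ℝ), |kernelError v / v| with hc
  have hc0 : 0 ≤ c := integral_nonneg fun v => abs_nonneg _
  refine ⟨c + 1, by linarith, ?_⟩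
  intro f f' I H0T hf _ hlim hf' hI hH
  obtain ⟨hGint, hGle⟩ :=
    integrableOn_and_integral_norm_dilation_le measurable_kernelError
      integrableOn_kernelError_div hf'
  refine ⟨fun x => ∫ u in Ioi (0 : ℝ), f' u * ((x⁻¹ * kernelError (x * u) : ℝ) : ℂ), ?_, hGint,
    hGle.trans ?_⟩
  · intro x hx
    have hxinv : 0 < x⁻¹ := inv_pos.2 hx
    have hcosint : IntegrableOn (fun u => f' u *
        ((x⁻¹ * (if π / 2 < x * u then cos (x * u) else 0) : ℝ) : ℂ)) (Ioi 0) := by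
      refine integrableOn_mul_ofReal_of_abs_le measurableSet_Ioi hf'
        (Measurable.const_mul (Measurable.ite ?_ (by fun_prop) measurable_const) _)
        (c := x⁻¹ * 1) fun u _ => ?_
      · exact measurableSet_lt measurable_const (by fun_prop)
      · rw [abs_mul, abs_of_pos hxinv]
        gcongr
        split_ifs
        · exact abs_cos_le_one _
        · simp
    have hprincipal : IntegrableOn (fun u => f' u *
        ((x⁻¹ * principalKernel (x * u) : ℝ) : ℂ)) (Ioi 0) := by
      refine integrableOn_mul_ofReal_of_abs_le measurableSet_Ioi hf'
        ((measurable_principalKernel.comp (measurable_const_mul x)).const_mul _)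
        (c := x⁻¹ * (7 + ∫ s in Ioi (2 : ℝ), 1 / (s ^ 2 - 1))) fun u hu => ?_
      rw [abs_mul, abs_of_pos hxinv]
      gcongr
      exact abs_principalKernel_le_const (mul_nonneg hx.le (le_of_lt hu))
    rw [tail_integral_eq hx hf hlim hf' (hI x hx),
      tendsto_nhds_unique (hH x hx) (tendsto_hilbert_sine_transform hf' hx),
      ← sub_eq_iff_eq_add', ← integral_const_mul,
      ← integral_sub hcosint (hprincipal.const_mul _)]
    congr 1 with u
    rw [kernelError]
    push_cast
    ring
  · gcongr
    linarith
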